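/- Let B be a finite-dimensional Bol superalgebra over a field K of characteristic 0 and let β be its Killing-Ricci form. Then: (1) β(x,y) = (−1)^{|x||y|} β(y,x) for all homogeneous x,y ∈ B (supersymmetry); (2) β(B₀,B₁) = 0 (consistency); (3) β([x,y,z],u) = −(−1)^{|z|(|x|+|y|)} β(z,[x,y,u]) for all homogeneous x,y,z,u ∈ B. -/

import Mathlib

open LinearMap

/-- The sign `(-1)^(i·j)` in the ground field, for parities `i j : ZMod 2`. -/
def sgn (K : Type*) [Field K] (i j : ZMod 2) : K := (-1 : K) ^ (i * j).val

/-- A Bol superalgebra over `K`: a `ZMod 2`-graded vector space with a bilinear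
product `mul` and a trilinear bracket `tri` satisfying (BS1)–(BS5) on
homogeneous elements. -/
structure BolSuper (K : Type*) (B : Type*) [Field K] [AddCommGroup B] [Module K B] where
  g : ZMod 2 → Submodule K B
  internal : DirectSum.IsInternal g
  mul : B →ₗ[K] B →ₗ[K] B
  tri : B →ₗ[K] B →ₗ[K] B →ₗ[K] B
  mul_mem : ∀ i j x y, x ∈ g i → y ∈ g j → mul x y ∈ g (i + j)
  tri_mem : ∀ i j k x y z, x ∈ g i → y ∈ g j → z ∈ g k → tri x y z ∈ g (i + j + k)
  bs1 : ∀ i j x y, x ∈ g i → y ∈ g j → mul x y = -(sgn K i j • mul y x)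
  bs2 : ∀ i j k x y z, x ∈ g i → y ∈ g j → z ∈ g k → tri x y z = -(sgn K i j • tri y x z)
  bs3 : ∀ i j k x y z, x ∈ g i → y ∈ g j → z ∈ g k →
    tri x y z + sgn K i (j + k) • tri y z x + sgn K k (i + j) • tri z x y = 0
  bs4 : ∀ i j k l m x y u v w, x ∈ g i → y ∈ g j → u ∈ g k → v ∈ g l → w ∈ g m →
    tri x y (tri u v w) = tri (tri x y u) v w + sgn K k (i + j) • tri u (tri x y v) w
      + sgn K (i + j) (k + l) • tri u v (tri x y w)
  bs5 : ∀ i j k l x y u v, x ∈ g i → y ∈ g j → u ∈ g k → v ∈ g l →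
    tri x y (mul u v) = sgn K k (i + j) • mul u (tri x y v) + mul (tri x y u) v
      + sgn K (i + j) (k + l) • tri u v (mul x y) + mul (mul x y) (mul u v)

variable {K B L : Type*} [Field K] [AddCommGroup B] [Module K B]

/-- `P` is a pseudo superderivation of degree `r` of the Bol superalgebra `A`
with companion `a ∈ A.g r`. -/
def IsPSD (A : BolSuper K B) (r : ZMod 2) (P : B →ₗ[K] B) (a : B) : Prop :=
  a ∈ A.g r ∧
  (∀ i x, x ∈ A.g i → P x ∈ A.g (i + r)) ∧
  (∀ i j k x y z, x ∈ A.g i → y ∈ A.g j → z ∈ A.g k →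
    P (A.tri x y z) = A.tri (P x) y z + sgn K r i • A.tri x (P y) z
      + sgn K r (i + j) • A.tri x y (P z)) ∧
  (∀ i j x y, x ∈ A.g i → y ∈ A.g j →
    P (A.mul x y) = sgn K r i • A.mul x (P y) + A.mul (P x) y
      + sgn K r (i + j) • A.tri x y a + A.mul a (A.mul x y))

/-- The bracket on pairs (pseudo superderivation, companion), for degrees `r`, `s`. -/
def pbrk (A : BolSuper K B) (r s : ZMod 2)
    (pa qb : (B →ₗ[K] B) × B) : (B →ₗ[K] B) × B :=
  (pa.1 ∘ₗ qb.1 - sgn K r s • (qb.1 ∘ₗ pa.1),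
   pa.1 qb.2 - sgn K r s • qb.1 pa.2 - A.mul pa.2 qb.2)

/-- The bracket on `B ⊕ H` (elements encoded as pairs `(x, (P, a))`),
for degrees `r`, `s`. -/
def lbrk (A : BolSuper K B) (r s : ZMod 2)
    (u v : B × ((B →ₗ[K] B) × B)) : B × ((B →ₗ[K] B) × B) :=
  (u.2.1 v.1 - sgn K r s • v.2.1 u.1,
   (A.tri u.1 v.1 + (pbrk A r s u.2 v.2).1,
    A.mul u.1 v.1 + (pbrk A r s u.2 v.2).2))

/-- The degree-`r` part of the span of the inner pairs `(D_{x,u}, x·u)` with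
`x` homogeneous in `B` and `u` homogeneous in the graded subspace `S`. -/
def IPSpan (A : BolSuper K B) (S : ZMod 2 → Submodule K B) (r : ZMod 2) :
    Submodule K ((B →ₗ[K] B) × B) :=
  Submodule.span K {pa | ∃ i j x u, i + j = r ∧ x ∈ A.g i ∧ u ∈ S j ∧
    pa = (A.tri x u, A.mul x u)}

/-- Data presenting a Lie superalgebra `L` as the standard enveloping Lie
superalgebra `L(B) = B ⊕ IPS(B,B)` of the Bol superalgebra `A`, together with
the grading involution `sigma` used to define supertraces. -/
structure EnvSetup (K B L : Type*) [Field K] [AddCommGroup B] [Module K B]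
    [AddCommGroup L] [Module K L] (A : BolSuper K B) where
  brk : L →ₗ[K] L →ₗ[K] L
  iota : B →ₗ[K] L
  jmap : ((B →ₗ[K] B) × B) →ₗ[K] L
  gL : ZMod 2 → Submodule K L
  gL_eq : ∀ r, gL r = (A.g r).map iota ⊔ (IPSpan A A.g r).map jmap
  surj : ∀ v : L, ∃ x pa, pa ∈ IPSpan A A.g 0 ⊔ IPSpan A A.g 1 ∧ v = iota x + jmap pa
  inj : ∀ x pa, pa ∈ IPSpan A A.g 0 ⊔ IPSpan A A.g 1 → iota x + jmap pa = 0 →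
    x = 0 ∧ pa = 0
  brk_bb : ∀ x y : B, brk (iota x) (iota y) = jmap (A.tri x y, A.mul x y)
  brk_pb : ∀ r pa, pa ∈ IPSpan A A.g r → ∀ x : B, brk (jmap pa) (iota x) = iota (pa.1 x)
  brk_bp : ∀ r s x pa, x ∈ A.g r → pa ∈ IPSpan A A.g s →
    brk (iota x) (jmap pa) = -(sgn K r s • iota (pa.1 x))
  brk_pp : ∀ r s pa qb, pa ∈ IPSpan A A.g r → qb ∈ IPSpan A A.g s →
    brk (jmap pa) (jmap qb) = jmap (pbrk A r s pa qb)
  sigma : L →ₗ[K] L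
  sigma0 : ∀ v ∈ gL 0, sigma v = v
  sigma1 : ∀ v ∈ gL 1, sigma v = -v

variable [AddCommGroup L] [Module K L]

/-- The Killing form `α(u,v) = str(ad u ∘ ad v)` of the enveloping Lie
superalgebra, the supertrace being computed via the grading involution. -/
noncomputable def killing {A : BolSuper K B} (E : EnvSetup K B L A) (u v : L) : K :=
  LinearMap.trace K L (E.sigma ∘ₗ E.brk u ∘ₗ E.brk v)

/-- The Killing-Ricci form of `B`: the restriction of the Killing form of the
standard enveloping Lie superalgebra to `B × B`. -/
noncomputable def kr {A : BolSuper K B} (E : EnvSetup K B L A) (x y : B) : K :=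
  killing E (E.iota x) (E.iota y)

theorem sgn_add_left (i j k : ZMod 2) : sgn K (i + j) k = sgn K i k * sgn K j k := by
  rw [sgn, sgn, sgn, ← pow_add]
  refine neg_one_pow_congr ?_
  revert i j k
  decide

theorem sgn_zero_left (i : ZMod 2) : sgn K 0 i = 1 := by
  simp [sgn]

theorem sgn_one_one : sgn K 1 1 = -1 := by
  rw [sgn, mul_one, ZMod.val_one, pow_one]

theorem sgn_comm (i j : ZMod 2) : sgn K i j = sgn K j i := by
  rw [sgn, sgn, mul_comm]

theorem sgn_add_right (i j k : ZMod 2) : sgn K i (j + k) = sgn K i j * sgn K i k := by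
  rw [sgn_comm, sgn_add_left, sgn_comm j, sgn_comm k]

theorem sgn_mul_self (i j : ZMod 2) : sgn K i j * sgn K i j = 1 := by
  rw [sgn, ← mul_pow]; simp

namespace BolSuper

/-- Linear maps on a Bol superalgebra agreeing on homogeneous elements are equal. -/
theorem linearMap_ext {M : Type*} [AddCommGroup M] [Module K M] (A : BolSuper K B)
    {f g : B →ₗ[K] M} (h : ∀ i, ∀ x ∈ A.g i, f x = g x) : f = g := by
  have htop : (⊤ : Submodule K B) ≤ LinearMap.eqLocus f g := by
    rw [← A.internal.submodule_iSup_eq_top]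
    exact iSup_le fun i x hx => h i x hx
  exact LinearMap.ext fun x => htop (Submodule.mem_top (x := x))

theorem mem_IPSpan (A : BolSuper K B) {i j : ZMod 2} {x y : B} (hx : x ∈ A.g i)
    (hy : y ∈ A.g j) : (A.tri x y, A.mul x y) ∈ IPSpan A A.g (i + j) :=
  Submodule.subset_span ⟨i, j, x, y, rfl, hx, hy, rfl⟩

theorem apply_mem (A : BolSuper K B) {r s : ZMod 2} {pa : (B →ₗ[K] B) × B}
    (hpa : pa ∈ IPSpan A A.g r) {z : B} (hz : z ∈ A.g s) : pa.1 z ∈ A.g (s + r) := by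
  induction hpa using Submodule.span_induction with
  | mem pa h =>
    obtain ⟨i, j, x, u, rfl, hx, hu, rfl⟩ := h
    rw [add_comm s]
    exact A.tri_mem i j s x u z hx hu hz
  | zero => simp
  | add p q _ _ hp hq => exact add_mem hp hq
  | smul c p _ hp => exact Submodule.smul_mem _ c hp

/-- The bracket of two inner pairs, by (BS4) and (BS5). -/
theorem pbrk_inner (A : BolSuper K B) {i j k l : ZMod 2} {x y u v : B} (hx : x ∈ A.g i)
    (hy : y ∈ A.g j) (hu : u ∈ A.g k) (hv : v ∈ A.g l) :
    pbrk A (i + j) (k + l) (A.tri x y, A.mul x y) (A.tri u v, A.mul u v) =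
      (A.tri (A.tri x y u) v, A.mul (A.tri x y u) v) +
        sgn K k (i + j) • (A.tri u (A.tri x y v), A.mul u (A.tri x y v)) := by
  refine Prod.ext ?_ ?_
  · refine A.linearMap_ext fun m w hw => ?_
    simp [pbrk, A.bs4 i j k l m x y u v w hx hy hu hv hw]
  · simp only [pbrk, A.bs5 i j k l x y u v hx hy hu hv, Prod.snd_add, Prod.smul_snd]
    abel

theorem pbrk_mem (A : BolSuper K B) {i j s : ZMod 2} {x y : B} (hx : x ∈ A.g i)
    (hy : y ∈ A.g j) {qb : (B →ₗ[K] B) × B} (hqb : qb ∈ IPSpan A A.g s) :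
    pbrk A (i + j) s (A.tri x y, A.mul x y) qb ∈ IPSpan A A.g (s + (i + j)) := by
  induction hqb using Submodule.span_induction with
  | mem qb h =>
    obtain ⟨k, l, u, v, rfl, hu, hv, rfl⟩ := h
    rw [A.pbrk_inner hx hy hu hv]
    refine add_mem ?_ (Submodule.smul_mem _ _ ?_)
    · rw [show k + l + (i + j) = i + j + k + l by ring]
      exact A.mem_IPSpan (A.tri_mem i j k x y u hx hy hu) hv
    · rw [show k + l + (i + j) = k + (i + j + l) by ring]
      exact A.mem_IPSpan hu (A.tri_mem i j l x y v hx hy hv)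
  | zero =>
    convert zero_mem (IPSpan A A.g (s + (i + j))) using 1
    simp [pbrk]
  | add p q _ _ hp hq =>
    convert add_mem hp hq using 1
    ext <;> simp [pbrk] <;> module
  | smul c p _ hp =>
    convert Submodule.smul_mem _ c hp using 1
    ext <;> simp [pbrk] <;> module

end BolSuper

namespace EnvSetup

variable {A : BolSuper K B}

/-- Linear maps on the enveloping superalgebra agreeing on homogeneous elements of `B` and
on homogeneous inner pairs are equal. -/
theorem linearMap_ext {M : Type*} [AddCommGroup M] [Module K M] (E : EnvSetup K B L A)
    {f g : L →ₗ[K] M} (hB : ∀ i, ∀ x ∈ A.g i, f (E.iota x) = g (E.iota x))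
    (hP : ∀ i, ∀ pa ∈ IPSpan A A.g i, f (E.jmap pa) = g (E.jmap pa)) : f = g := by
  have hB' : f ∘ₗ E.iota = g ∘ₗ E.iota := A.linearMap_ext hB
  have hP' : IPSpan A A.g 0 ⊔ IPSpan A A.g 1 ≤
      LinearMap.eqLocus (f ∘ₗ E.jmap) (g ∘ₗ E.jmap) := sup_le (hP 0) (hP 1)
  refine LinearMap.ext fun v => ?_
  obtain ⟨x, pa, hpa, rfl⟩ := E.surj v
  rw [map_add, map_add]
  exact congrArg₂ _ (LinearMap.congr_fun hB' x) (hP' hpa)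

theorem iota_mem (E : EnvSetup K B L A) {i : ZMod 2} {x : B} (hx : x ∈ A.g i) :
    E.iota x ∈ E.gL i := by
  rw [E.gL_eq]
  exact Submodule.mem_sup_left (Submodule.mem_map_of_mem hx)

theorem jmap_mem (E : EnvSetup K B L A) {i : ZMod 2} {pa : (B →ₗ[K] B) × B}
    (hpa : pa ∈ IPSpan A A.g i) : E.jmap pa ∈ E.gL i := by
  rw [E.gL_eq]
  exact Submodule.mem_sup_right (Submodule.mem_map_of_mem hpa)

/-- The endomorphism `f` of the enveloping superalgebra is homogeneous of degree `i`. -/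
def IsHomogEnd (E : EnvSetup K B L A) (i : ZMod 2) (f : Module.End K L) : Prop :=
  ∀ r, ∀ v ∈ E.gL r, f v ∈ E.gL (r + i)

theorem IsHomogEnd.mul {E : EnvSetup K B L A} {i j : ZMod 2} {f g : Module.End K L}
    (hf : E.IsHomogEnd i f) (hg : E.IsHomogEnd j g) : E.IsHomogEnd (i + j) (f * g) := by
  intro r v hv
  rw [add_comm i, ← add_assoc]
  exact hf _ _ (hg _ _ hv)

theorem isHomogEnd_of_generators {E : EnvSetup K B L A} {i : ZMod 2} {f : Module.End K L}
    (hB : ∀ r, ∀ x ∈ A.g r, f (E.iota x) ∈ E.gL (r + i))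
    (hP : ∀ r, ∀ pa ∈ IPSpan A A.g r, f (E.jmap pa) ∈ E.gL (r + i)) :
    E.IsHomogEnd i f := by
  intro r
  change E.gL r ≤ (E.gL (r + i)).comap f
  rw [E.gL_eq r, sup_le_iff, Submodule.map_le_iff_le_comap, Submodule.map_le_iff_le_comap]
  exact ⟨hB r, hP r⟩

theorem isHomogEnd_brk_iota (E : EnvSetup K B L A) {i : ZMod 2} {x : B} (hx : x ∈ A.g i) :
    E.IsHomogEnd i (E.brk (E.iota x)) := by
  refine isHomogEnd_of_generators (fun r y hy => ?_) (fun r pa hpa => ?_)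
  · rw [E.brk_bb, add_comm]
    exact E.jmap_mem (A.mem_IPSpan hx hy)
  · rw [E.brk_bp i r x pa hx hpa, add_comm]
    exact neg_mem (Submodule.smul_mem _ _ (E.iota_mem (A.apply_mem hpa hx)))

theorem isHomogEnd_brk_inner (E : EnvSetup K B L A) {i j : ZMod 2} {x y : B}
    (hx : x ∈ A.g i) (hy : y ∈ A.g j) :
    E.IsHomogEnd (i + j) (E.brk (E.jmap (A.tri x y, A.mul x y))) := by
  refine isHomogEnd_of_generators (fun r z hz => ?_) (fun r pa hpa => ?_)
  · rw [E.brk_pb _ _ (A.mem_IPSpan hx hy)]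
    exact E.iota_mem (A.apply_mem (A.mem_IPSpan hx hy) hz)
  · rw [E.brk_pp _ r _ pa (A.mem_IPSpan hx hy) hpa]
    exact E.jmap_mem (A.pbrk_mem hx hy hpa)

theorem sigma_apply (E : EnvSetup K B L A) {i : ZMod 2} {v : L} (hv : v ∈ E.gL i) :
    E.sigma v = sgn K i 1 • v := by
  obtain rfl | rfl : i = 0 ∨ i = 1 := by
    clear hv
    revert i
    decide
  · rw [E.sigma0 v hv, sgn_zero_left, one_smul]
  · rw [E.sigma1 v hv, sgn_one_one, neg_one_smul]

theorem IsHomogEnd.sigma_mul {E : EnvSetup K B L A} {i : ZMod 2} {f : Module.End K L}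
    (hf : E.IsHomogEnd i f) : (E.sigma : Module.End K L) * f = sgn K i 1 • (f * E.sigma) := by
  have key : ∀ r, ∀ v ∈ E.gL r,
      ((E.sigma : Module.End K L) * f) v = (sgn K i 1 • (f * E.sigma)) v := by
    intro r v hv
    rw [Module.End.mul_apply, LinearMap.smul_apply, Module.End.mul_apply,
      E.sigma_apply (hf r v hv), E.sigma_apply hv, map_smul, smul_smul, sgn_add_left, mul_comm]
  exact E.linearMap_ext (fun r x hx => key r _ (E.iota_mem hx))
    (fun r pa hpa => key r _ (E.jmap_mem hpa))

/-- The supertrace of an odd endomorphism vanishes. -/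
theorem IsHomogEnd.trace_sigma_mul_eq_zero [CharZero K] {E : EnvSetup K B L A}
    {f : Module.End K L} (hf : E.IsHomogEnd 1 f) :
    LinearMap.trace K L (E.sigma * f) = 0 := by
  have h : LinearMap.trace K L (E.sigma * f) = -LinearMap.trace K L (E.sigma * f) := by
    conv_lhs => rw [hf.sigma_mul, map_smul, LinearMap.trace_mul_comm]
    rw [sgn_one_one, neg_one_smul]
  exact self_eq_neg.mp h

/-- The supertrace vanishes on supercommutators. -/
theorem IsHomogEnd.trace_sigma_mul_comm [CharZero K] {E : EnvSetup K B L A} {i j : ZMod 2}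
    {f g : Module.End K L} (hf : E.IsHomogEnd i f) (hg : E.IsHomogEnd j g) :
    LinearMap.trace K L (E.sigma * (f * g)) =
      sgn K i j * LinearMap.trace K L (E.sigma * (g * f)) := by
  by_cases hij : i + j = 1
  · have hfg := hf.mul hg
    have hgf := hg.mul hf
    rw [hij] at hfg
    rw [add_comm, hij] at hgf
    rw [hfg.trace_sigma_mul_eq_zero, hgf.trace_sigma_mul_eq_zero, mul_zero]
  · have hs : sgn K i j = sgn K i 1 := by
      have hval : (i * j).val = (i * 1).val := by
        clear hf hg
        revert i j
        decide
      rw [sgn, sgn, hval]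
    rw [← mul_assoc, hf.sigma_mul, smul_mul_assoc, map_smul, mul_assoc,
      LinearMap.trace_mul_comm, hs, smul_eq_mul, mul_assoc]

/-- The adjoint action of `[x, y, z] = [[x, y], z]`: a case of the super Jacobi identity. -/
theorem brk_iota_tri (E : EnvSetup K B L A) {i j k : ZMod 2} {x y z : B}
    (hx : x ∈ A.g i) (hy : y ∈ A.g j) (hz : z ∈ A.g k) :
    (E.brk (E.iota (A.tri x y z)) : Module.End K L) =
      (E.brk (E.jmap (A.tri x y, A.mul x y)) : Module.End K L) * E.brk (E.iota z) -
        sgn K k (i + j) •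
          ((E.brk (E.iota z) : Module.End K L) * E.brk (E.jmap (A.tri x y, A.mul x y))) := by
  have hD := A.mem_IPSpan hx hy
  refine E.linearMap_ext (fun l w hw => ?_) (fun s pa hpa => ?_)
  · simp only [LinearMap.sub_apply, LinearMap.smul_apply, Module.End.mul_apply, E.brk_bb,
      E.brk_pb _ _ hD, E.brk_pp _ _ _ _ hD (A.mem_IPSpan hz hw), A.pbrk_inner hx hy hz hw,
      map_add, map_smul, add_sub_cancel_right]
  · simp only [LinearMap.sub_apply, LinearMap.smul_apply, Module.End.mul_apply,
      E.brk_pp _ _ _ _ hD hpa, E.brk_bp _ _ _ _ hz hpa,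
      E.brk_bp _ _ _ _ (A.tri_mem i j k x y z hx hy hz) hpa,
      E.brk_bp _ _ _ _ hz (A.pbrk_mem hx hy hpa), map_neg, map_smul, E.brk_pb _ _ hD]
    simp only [pbrk, LinearMap.sub_apply, LinearMap.comp_apply, LinearMap.smul_apply, map_sub,
      map_smul, sgn_add_left (i + j) k s, sgn_add_right k s (i + j)]
    have h := sgn_mul_self (K := K) k (i + j)
    match_scalars
    · linear_combination (sgn K (i + j) s * sgn K k s) * h
    · linear_combination (-sgn K k s) * h

theorem kr_eq (E : EnvSetup K B L A) (x y : B) :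
    kr E x y = LinearMap.trace K L (E.sigma *
      ((E.brk (E.iota x) : Module.End K L) * E.brk (E.iota y))) :=
  rfl

end EnvSetup

/-- the Killing-Ricci form `β` of a finite-dimensional Bol
superalgebra is (1) supersymmetric, (2) consistent (`β(B₀,B₁)=0`), and (3)
satisfies `β([x,y,z],u) = -(-1)^{|z|(|x|+|y|)} β(z,[x,y,u])`. -/
theorem stmt7 {K B L : Type*} [Field K] [CharZero K]
    [AddCommGroup B] [Module K B] [FiniteDimensional K B]
    [AddCommGroup L] [Module K L] [FiniteDimensional K L]
    (A : BolSuper K B) (E : EnvSetup K B L A) :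
    (∀ (i j : ZMod 2) (x y : B), x ∈ A.g i → y ∈ A.g j →
      kr E x y = sgn K i j * kr E y x) ∧
    (∀ x y : B, x ∈ A.g 0 → y ∈ A.g 1 → kr E x y = 0) ∧
    (∀ (i j k l : ZMod 2) (x y z u : B),
      x ∈ A.g i → y ∈ A.g j → z ∈ A.g k → u ∈ A.g l →
      kr E (A.tri x y z) u = -(sgn K k (i + j) * kr E z (A.tri x y u))) := by
  refine ⟨fun i j x y hx hy => ?_, fun x y hx hy => ?_, fun i j k l x y z u hx hy hz hu => ?_⟩
  · exact (E.isHomogEnd_brk_iota hx).trace_sigma_mul_comm (E.isHomogEnd_brk_iota hy)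
  · have h := (E.isHomogEnd_brk_iota hx).mul (E.isHomogEnd_brk_iota hy)
    rw [zero_add] at h
    exact h.trace_sigma_mul_eq_zero
  · have hH := E.isHomogEnd_brk_inner hx hy
    have hZ := E.isHomogEnd_brk_iota hz
    have hU := E.isHomogEnd_brk_iota hu
    have hcomm := hH.trace_sigma_mul_comm (hZ.mul hU)
    rw [sgn_add_right, sgn_comm _ k, sgn_comm _ l] at hcomm
    rw [E.kr_eq, E.kr_eq, E.brk_iota_tri hx hy hz, E.brk_iota_tri hx hy hu]
    simp only [sub_mul, mul_sub, smul_mul_assoc, mul_smul_comm, map_sub, map_smul,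
      smul_eq_mul, mul_assoc] at hcomm ⊢
    linear_combination hcomm
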